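/- Let 𝓕 be a finite nonempty family of finite subsets of a set U satisfying axioms L1 and L2, and let S ∈ 𝓕 with S ≠ ⋃𝓕. Then there exists an element x ∉ S with S ∪ {x} ∈ 𝓕. (Hence ⋃𝓕 is the unique sink of the learning space: every other state has an outgoing edge.) -/

import Mathlib

/-- Axiom L1 of a learning space. -/
def AxiomL1 {U : Type*} [DecidableEq U] (F : Set (Finset U)) : Prop :=
  ∀ S ∈ F, S.Nonempty → ∃ x ∈ S, S.erase x ∈ F

/-- Axiom L2 of a learning space. -/
def AxiomL2 {U : Type*} [DecidableEq U] (F : Set (Finset U)) : Prop :=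
  ∀ (S : Finset U) (x y : U), S ∈ F → insert x S ∈ F → insert y S ∈ F →
    insert x (insert y S) ∈ F

/-- A family of finite sets satisfying axioms L1 and L2 is closed under unions. -/
theorem AxiomL2.union_mem {U : Type*} [DecidableEq U] {F : Set (Finset U)}
    (hL2 : AxiomL2 F) (hL1 : AxiomL1 F) (S T : Finset U) (hS : S ∈ F) (hT : T ∈ F) :
    S ∪ T ∈ F := by
  induction hn : S.card + T.card using Nat.strong_induction_on generalizing S T with
  | _ n ih =>
    rcases S.eq_empty_or_nonempty with rfl | hSne
    · simpa using hT
    rcases T.eq_empty_or_nonempty with rfl | hTne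
    · simpa using hS
    obtain ⟨x, hxS, hx⟩ := hL1 S hS hSne
    obtain ⟨y, hyT, hy⟩ := hL1 T hT hTne
    have hcS := Finset.card_erase_lt_of_mem hxS
    have hcT := Finset.card_erase_lt_of_mem hyT
    have hST : S ∪ T.erase y ∈ F := ih _ (by omega) S (T.erase y) hS hy rfl
    have hTS : S.erase x ∪ T ∈ F := ih _ (by omega) (S.erase x) T hx hT rfl
    have h : S.erase x ∪ T.erase y ∈ F := ih _ (by omega) _ _ hx hy rfl
    have key := hL2 _ x y h
      (by rwa [← Finset.insert_union, Finset.insert_erase hxS])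
      (by rwa [← Finset.union_insert, Finset.insert_erase hyT])
    rwa [← Finset.union_insert, Finset.insert_erase hyT, ← Finset.insert_union,
      Finset.insert_erase hxS] at key

/-- If some member of the family is not contained in `S`, then one element of it outside `S`
can be added to `S`. -/
theorem exists_insert_mem_of_not_subset {U : Type*} [DecidableEq U] {F : Set (Finset U)}
    (hL1 : AxiomL1 F) (hL2 : AxiomL2 F) {S : Finset U} (hS : S ∈ F) (T : Finset U)
    (hT : T ∈ F) (hTS : ¬ T ⊆ S) : ∃ x ∈ T, x ∉ S ∧ insert x S ∈ F := by
  induction T using Finset.strongInduction with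
  | H T ih =>
    have hTne : T.Nonempty := by
      rw [Finset.nonempty_iff_ne_empty]
      rintro rfl
      exact hTS (Finset.empty_subset S)
    obtain ⟨x, hxT, hx⟩ := hL1 T hT hTne
    by_cases hsub : T.erase x ⊆ S
    · have hxS : x ∉ S := fun hxS => hTS <| by
        rw [← Finset.insert_erase hxT]
        exact Finset.insert_subset hxS hsub
      refine ⟨x, hxT, hxS, ?_⟩
      have hU := hL2.union_mem hL1 S T hS hT
      rwa [← Finset.insert_erase hxT, Finset.union_insert,
        Finset.union_eq_left.mpr hsub] at hU
    · obtain ⟨z, hz, hzS, hins⟩ := ih _ (Finset.erase_ssubset hxT) hx hsub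
      exact ⟨z, Finset.mem_of_mem_erase hz, hzS, hins⟩

/-- In a finite nonempty family of finite sets satisfying axioms L1 and L2, every
member other than the union of the whole family has an outgoing edge: some element
can be added to it while staying in the family. Hence the union of the family is
the unique sink of the learning space. -/
theorem exists_outgoing {U : Type*} [DecidableEq U] (F : Set (Finset U))
    (hfin : F.Finite) (hne : F.Nonempty)
    (hL1 : AxiomL1 F) (hL2 : AxiomL2 F)
    (S : Finset U) (hS : S ∈ F) (hStop : S ≠ hfin.toFinset.sup id) :
    ∃ x ∉ S, insert x S ∈ F := by
  by_contra! hcon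
  refine hStop (le_antisymm (Finset.le_sup (f := id) (hfin.mem_toFinset.mpr hS)) ?_)
  refine Finset.sup_le fun T hT => ?_
  by_contra hTS
  obtain ⟨x, -, hxS, hx⟩ :=
    exists_insert_mem_of_not_subset hL1 hL2 hS T (hfin.mem_toFinset.mp hT) hTS
  exact hcon x hxS hx
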